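/- The ring of formal Laurent series k_≺((x_1,...,x_n)) := ⋃_{e ∈ ℤ^n} x^e k_≺⟦x_1,...,x_n⟧, where k_≺⟦x_1,...,x_n⟧ is the union over all cones C compatible with ≺ of k_C⟦x_1,...,x_n⟧, is a ring under the usual addition and multiplication; if k is a field, then k_≺((x_1,...,x_n)) is a field. -/

import Mathlib

/-- Membership of an integer vector in the cone generated by the `v i`. -/
def InConeZ {n m : ℕ} (v : Fin m → (Fin n → ℤ)) (g : Fin n → ℤ) : Prop :=
  ∃ α : Fin m → ℝ, (∀ i, 0 ≤ α i) ∧ ∀ j, (g j : ℝ) = ∑ i, α i * (v i j : ℝ)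

/-- A function `f : ℤ^n → k` is a formal Laurent series for the additive total
order `r` if its support is contained in `e + C` for some `e ∈ ℤ^n` and some cone `C`
compatible with `r`. -/
def IsLaurentSupported {n : ℕ} (k : Type*) [Zero k]
    (r : (Fin n → ℤ) → (Fin n → ℤ) → Prop) (f : (Fin n → ℤ) → k) : Prop :=
  ∃ (e : Fin n → ℤ) (m : ℕ) (v : Fin m → (Fin n → ℤ)),
    (∀ i, r 0 (v i)) ∧ ∀ g, f g ≠ 0 → InConeZ v (g - e)

section Abs
variable {Γ : Type*} [AddCommGroup Γ] [LinearOrder Γ] [IsOrderedAddMonoid Γ]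

def FGSupp (A : Set Γ) : Prop :=
  ∃ (e : Γ) (S : Finset Γ), (∀ s ∈ S, 0 ≤ s) ∧ ∀ g ∈ A, g - e ∈ AddSubmonoid.closure (S : Set Γ)

theorem FGSupp.mono {A B : Set Γ} (h : FGSupp B) (hAB : A ⊆ B) : FGSupp A := by
  obtain ⟨e, S, hS, hB⟩ := h
  exact ⟨e, S, hS, fun g hg => hB g (hAB hg)⟩

theorem FGSupp.isPWO {A : Set Γ} (h : FGSupp A) : A.IsPWO := by
  obtain ⟨e, S, hS, hA⟩ := h
  have h1 : (AddSubmonoid.closure (S : Set Γ) : Set Γ).IsPWO :=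
    Set.IsPWO.addSubmonoid_closure hS (S.finite_toSet.isPWO)
  refine ((Set.isPWO_singleton e).add h1).mono ?_
  intro g hg
  exact Set.mem_add.2 ⟨e, rfl, g - e, hA g hg, by abel⟩

theorem fgSupp_of_finite {A : Set Γ} (F S : Finset Γ) (hS : ∀ s ∈ S, 0 ≤ s)
    (h : ∀ g ∈ A, ∃ f ∈ F, g - f ∈ AddSubmonoid.closure (S : Set Γ)) : FGSupp A := by
  classical
  obtain ⟨e, he⟩ : ∃ e, ∀ f ∈ F, e ≤ f := by
    rcases F.eq_empty_or_nonempty with rfl | hF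
    · exact ⟨0, by simp⟩
    · exact ⟨F.min' hF, fun f hf => F.min'_le f hf⟩
  refine ⟨e, S ∪ F.image (fun f => f - e), ?_, ?_⟩
  · intro s hs
    rcases Finset.mem_union.1 hs with hs | hs
    · exact hS s hs
    · obtain ⟨f, hf, rfl⟩ := Finset.mem_image.1 hs
      exact sub_nonneg.2 (he f hf)
  · intro g hg
    obtain ⟨f, hf, hgf⟩ := h g hg
    have h1 : g - f ∈ AddSubmonoid.closure ((S ∪ F.image (fun f => f - e) : Finset Γ) : Set Γ) :=
      AddSubmonoid.closure_mono (by simp) hgf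
    have h2 : f - e ∈ AddSubmonoid.closure ((S ∪ F.image (fun f => f - e) : Finset Γ) : Set Γ) :=
      AddSubmonoid.subset_closure (by
        simp only [Finset.coe_union, Set.mem_union, Finset.mem_coe, Finset.mem_image]
        exact Or.inr ⟨f, hf, rfl⟩)
    have := add_mem h1 h2
    rwa [sub_add_sub_cancel] at this

theorem FGSupp.union {A B : Set Γ} (hA : FGSupp A) (hB : FGSupp B) : FGSupp (A ∪ B) := by
  classical
  obtain ⟨e, S, hS, hA⟩ := hA
  obtain ⟨e', S', hS', hB⟩ := hB
  refine fgSupp_of_finite {e, e'} (S ∪ S') ?_ ?_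
  · intro s hs
    rcases Finset.mem_union.1 hs with hs | hs
    · exact hS s hs
    · exact hS' s hs
  · rintro g (hg | hg)
    · exact ⟨e, by simp, AddSubmonoid.closure_mono (by simp) (hA g hg)⟩
    · exact ⟨e', by simp, AddSubmonoid.closure_mono (by simp) (hB g hg)⟩

open Pointwise in
theorem FGSupp.add {A B : Set Γ} (hA : FGSupp A) (hB : FGSupp B) : FGSupp (A + B) := by
  classical
  obtain ⟨e, S, hS, hA⟩ := hA
  obtain ⟨e', S', hS', hB⟩ := hB
  refine ⟨e + e', S ∪ S', ?_, ?_⟩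
  · intro s hs
    rcases Finset.mem_union.1 hs with hs | hs
    · exact hS s hs
    · exact hS' s hs
  · intro g hg
    obtain ⟨a, ha, b, hb, rfl⟩ := Set.mem_add.1 hg
    rw [add_sub_add_comm]
    exact add_mem (AddSubmonoid.closure_mono (by simp) (hA a ha))
      (AddSubmonoid.closure_mono (by simp) (hB b hb))

/-- Dickson's lemma: we may take any lower bound as the apex. -/
theorem FGSupp.apex {A : Set Γ} (hA : FGSupp A) (e0 : Γ) (h0 : ∀ g ∈ A, e0 ≤ g) :
    ∃ S : Finset Γ, (∀ s ∈ S, 0 ≤ s) ∧ ∀ g ∈ A, g - e0 ∈ AddSubmonoid.closure (S : Set Γ) := by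
  classical
  obtain ⟨e, S, hS, hA⟩ := hA
  let φ : (S → ℕ) → Γ := fun a => ∑ i, a i • (i : Γ)
  let P : (S → ℕ) → Prop := fun a => 0 ≤ e - e0 + φ a
  have hfin : {a | Minimal P a}.Finite :=
    WellQuasiOrderedLE.finite_of_isAntichain (setOfPred_minimal_antichain P)
  have hφ : ∀ a, φ a ∈ AddSubmonoid.closure (S : Set Γ) := fun a =>
    sum_mem fun i _ => nsmul_mem (AddSubmonoid.subset_closure i.2) _
  refine ⟨S ∪ hfin.toFinset.image (fun a => e - e0 + φ a), ?_, ?_⟩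
  · intro s hs
    rcases Finset.mem_union.1 hs with hs | hs
    · exact hS s hs
    · obtain ⟨a, ha, rfl⟩ := Finset.mem_image.1 hs
      exact ((Set.Finite.mem_toFinset _).1 ha).prop
  · intro g hg
    obtain ⟨a, ha⟩ := AddSubmonoid.mem_closure_finset'.1 (hA g hg)
    have ha' : φ a = g - e := by simpa [φ] using ha.symm
    have hPa : P a := by
      simp only [P, ha']
      have := sub_nonneg.2 (h0 g hg)
      convert this using 1
      abel
    obtain ⟨b, hba, hb⟩ := exists_minimal_le_of_wellFoundedLT P a hPa
    have h3 : φ a = φ b + φ (a - b) := by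
      simp only [φ, ← Finset.sum_add_distrib, ← add_nsmul, Pi.sub_apply]
      refine Finset.sum_congr rfl fun i _ => ?_
      rw [Nat.add_sub_cancel' (hba i)]
    have h4 : g - e0 = (e - e0 + φ b) + φ (a - b) := by
      rw [add_assoc, ← h3, ha']; abel
    rw [h4]
    refine add_mem (AddSubmonoid.subset_closure ?_)
      (AddSubmonoid.closure_mono (by simp) (hφ _))
    simp only [Finset.coe_union, Set.mem_union, Finset.mem_coe, Finset.mem_image]
    exact Or.inr ⟨b, (Set.Finite.mem_toFinset _).2 hb, rfl⟩

def laurentSubring (Γ : Type*) [AddCommGroup Γ] [LinearOrder Γ] [IsOrderedAddMonoid Γ]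
    (k : Type*) [CommRing k] : Subring (HahnSeries Γ k) where
  carrier := {f | FGSupp f.support}
  mul_mem' {a b} ha hb := (FGSupp.add ha hb).mono (HahnSeries.support_mul_subset)
  one_mem' := ⟨0, ∅, by simp, by
    intro g hg
    have : g = 0 := by
      by_contra h
      exact hg (by simp [HahnSeries.coeff_one, h])
    simp [this]⟩
  add_mem' {a b} ha hb := (FGSupp.union ha hb).mono (HahnSeries.support_add_subset _ _)
  zero_mem' := ⟨0, ∅, by simp, by simp⟩
  neg_mem' {a} ha := by simpa using ha

theorem laurent_inv {k : Type*} [CommRing k] [IsDomain k] (f g : HahnSeries Γ k)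
    (hf : FGSupp f.support) (hfg : f * g = 1) : FGSupp g.support := by
  have hf0 : f ≠ 0 := by rintro rfl; simp at hfg
  obtain ⟨S, hS, hfS⟩ := hf.apex f.order (fun a ha => HahnSeries.order_le_of_coeff_ne_zero ha)
  refine ⟨- f.order, S, hS, ?_⟩
  by_contra hcon
  push Not at hcon
  set M := AddSubmonoid.closure (S : Set Γ)
  let B : Set Γ := {x | x ∈ g.support ∧ x - -f.order ∉ M}
  have hB : B.IsWF := g.isWF_support.mono fun x hx => hx.1
  obtain ⟨x0, hx0⟩ := hcon
  have hne : B.Nonempty := ⟨x0, hx0⟩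
  let γ := hB.min hne
  have hγ : γ ∈ B := hB.min_mem hne
  have hmin : ∀ b ∈ B, γ ≤ b := fun b hb => hB.min_le hne hb
  have hγ0 : f.order + γ ≠ 0 := by
    intro h
    apply hγ.2
    rw [sub_neg_eq_add, add_comm, h]
    exact zero_mem _
  have hc : (f * g).coeff (f.order + γ) = 0 := by
    rw [hfg, HahnSeries.coeff_one, if_neg hγ0]
  rw [HahnSeries.coeff_mul, Finset.sum_eq_single (f.order, γ)] at hc
  · rcases mul_eq_zero.1 hc with h | h
    · exact hf0 (HahnSeries.coeff_order_eq_zero.1 h)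
    · exact hγ.1 h
  · rintro ⟨a, b⟩ hab hne'
    exfalso
    rw [Finset.mem_antidiagonal] at hab
    obtain ⟨ha, hb, hab⟩ := hab
    simp only at ha hb hab
    have hle := HahnSeries.order_le_of_coeff_ne_zero ha
    have hlt : f.order < a := by
      refine lt_of_le_of_ne hle ?_
      rintro rfl
      exact hne' (by rw [add_left_cancel hab])
    have hbγ : b < γ := by
      by_contra hge
      have := add_lt_add_of_lt_of_le hlt (not_lt.1 hge)
      rw [hab] at this
      exact lt_irrefl _ this
    have hbM : b - -f.order ∈ M := by
      by_contra h
      exact absurd (hmin b ⟨hb, h⟩) (not_le.2 hbγ)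
    apply hγ.2
    have := add_mem (hfS a ha) hbM
    convert this using 1
    have : γ = a + b - f.order := by rw [hab]; abel
    rw [this]; abel
  · intro h
    exfalso
    apply h
    rw [Finset.mem_antidiagonal]
    refine ⟨?_, hγ.1, rfl⟩
    exact fun h => hf0 (HahnSeries.coeff_order_eq_zero.1 h)

end Abs

theorem InConeZ.exists_nat {n m : ℕ} (v : Fin m → (Fin n → ℤ)) :
    ∃ F : Finset (Fin n → ℤ), ∀ g, InConeZ v g →
      ∃ f ∈ F, ∃ a : Fin m → ℕ, g = f + ∑ i, a i • v i := by
  classical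
  refine ⟨Fintype.piFinset (fun j => Finset.Icc (-∑ i, |v i j|) (∑ i, |v i j|)), ?_⟩
  rintro g ⟨α, hα, hg⟩
  refine ⟨g - ∑ i, ⌊α i⌋₊ • v i, ?_, fun i => ⌊α i⌋₊, by simp⟩
  rw [Fintype.mem_piFinset]
  intro j
  rw [Finset.mem_Icc, ← abs_le]
  have h1 : (((g - ∑ i, ⌊α i⌋₊ • v i) j : ℤ) : ℝ) = ∑ i, (α i - ⌊α i⌋₊) * (v i j : ℝ) := by
    simp only [Pi.sub_apply, Finset.sum_apply, Pi.smul_apply, sub_mul, Finset.sum_sub_distrib]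
    push_cast
    rw [hg j]
    simp
  have h2 : |(((g - ∑ i, ⌊α i⌋₊ • v i) j : ℤ) : ℝ)| ≤ ∑ i, |(v i j : ℝ)| := by
    rw [h1]
    refine (Finset.abs_sum_le_sum_abs _ _).trans (Finset.sum_le_sum fun i _ => ?_)
    rw [abs_mul]
    have h3 : |α i - ⌊α i⌋₊| ≤ 1 := by
      rw [abs_le]
      constructor
      · linarith [Nat.floor_le (hα i)]
      · linarith [Nat.lt_floor_add_one (α i)]
    exact mul_le_of_le_one_left (abs_nonneg _) h3
  exact_mod_cast h2

theorem InConeZ.of_closure {n : ℕ} (S : Finset (Fin n → ℤ)) :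
    ∃ (m : ℕ) (v : Fin m → (Fin n → ℤ)), (∀ i, v i ∈ S ∧ v i ≠ 0) ∧
      ∀ g ∈ AddSubmonoid.closure (S : Set (Fin n → ℤ)), InConeZ v g := by
  classical
  let T := S.filter (· ≠ 0)
  have hzero : InConeZ (fun i => (T.equivFin.symm i : Fin n → ℤ)) 0 :=
    ⟨0, by simp, by simp⟩
  refine ⟨T.card, fun i => (T.equivFin.symm i : Fin n → ℤ), ?_, ?_⟩
  · intro i
    exact Finset.mem_filter.1 (T.equivFin.symm i).2
  · intro g hg
    induction hg using AddSubmonoid.closure_induction with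
    | mem x hx =>
      by_cases h : x = 0
      · rw [h]; exact hzero
      · have hxT : x ∈ T := Finset.mem_filter.2 ⟨hx, h⟩
        refine ⟨Pi.single (T.equivFin ⟨x, hxT⟩) 1, ?_, ?_⟩
        · intro i
          by_cases hi : i = T.equivFin ⟨x, hxT⟩
          · subst hi; simp
          · simp [Pi.single_eq_of_ne hi]
        · intro j
          rw [Finset.sum_eq_single (T.equivFin ⟨x, hxT⟩)]
          · simp
          · intro i _ hi
            simp [Pi.single_eq_of_ne hi]
          · simp
    | zero => exact hzero
    | add x y _ _ hx hy =>
      obtain ⟨a, ha, hx⟩ := hx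
      obtain ⟨b, hb, hy⟩ := hy
      refine ⟨a + b, fun i => add_nonneg (ha i) (hb i), fun j => ?_⟩
      simp only [Pi.add_apply, add_mul, Finset.sum_add_distrib]
      push_cast
      rw [hx, hy]

/-- A copy of `ℤ^n` without the product order. -/
def OG (n : ℕ) : Type := Fin n → ℤ

instance (n : ℕ) : AddCommGroup (OG n) := inferInstanceAs (AddCommGroup (Fin n → ℤ))

theorem isLaurentSupported_iff {n : ℕ} {k : Type*} [Zero k]
    (r : (Fin n → ℤ) → (Fin n → ℤ) → Prop) [LinearOrder (OG n)] [IsOrderedAddMonoid (OG n)]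
    (hr : ∀ a b : OG n, a < b ↔ r a b) (f : (Fin n → ℤ) → k) :
    IsLaurentSupported k r f ↔ FGSupp (Γ := OG n) (Function.support f) := by
  classical
  constructor
  · rintro ⟨e, m, v, hv, hf⟩
    obtain ⟨F, hF⟩ := InConeZ.exists_nat v
    refine fgSupp_of_finite (Γ := OG n) (F.image (fun x : Fin n → ℤ => (x + e : Fin n → ℤ)))
      (Finset.univ.image v) ?_ ?_
    · intro s hs
      obtain ⟨i, -, rfl⟩ := Finset.mem_image.1 hs
      exact le_of_lt ((hr _ _).2 (hv i))
    · intro (g : Fin n → ℤ) hg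
      obtain ⟨x, hx, a, hgx⟩ := hF _ (hf g hg)
      refine ⟨(x + e : Fin n → ℤ), Finset.mem_image_of_mem _ hx, ?_⟩
      have : g - (x + e) = ∑ i, a i • v i := by
        have h : g - (x + e) = (g - e) - x := by abel
        rw [h, hgx]; exact add_sub_cancel_left _ _
      change (g - (x + e) : Fin n → ℤ) ∈ AddSubmonoid.closure (M := Fin n → ℤ) _
      rw [this]
      exact sum_mem fun i _ => nsmul_mem (AddSubmonoid.subset_closure
        (Finset.mem_coe.2 (Finset.mem_image_of_mem (β := OG n) v (Finset.mem_univ i)))) _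
  · rintro ⟨e, S, hS, hf⟩
    obtain ⟨m, v, hv, hc⟩ := InConeZ.of_closure (n := n) S
    refine ⟨e, m, v, fun i => ?_, fun g hg => hc _ (hf g hg)⟩
    exact (hr _ _).1 (lt_of_le_of_ne (hS _ (hv i).1) (Ne.symm (hv i).2))

/-- Laurent series as a subring of Hahn series. -/
def laurentEquiv {n : ℕ} (k : Type*) [CommRing k]
    (r : (Fin n → ℤ) → (Fin n → ℤ) → Prop) [LinearOrder (OG n)] [IsOrderedAddMonoid (OG n)]
    (hr : ∀ a b : OG n, a < b ↔ r a b) :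
    {f : (Fin n → ℤ) → k // IsLaurentSupported k r f} ≃ laurentSubring (OG n) k where
  toFun f := ⟨⟨f.1, ((isLaurentSupported_iff r hr f.1).1 f.2).isPWO⟩,
    (isLaurentSupported_iff r hr f.1).1 f.2⟩
  invFun f := ⟨f.1.coeff, (isLaurentSupported_iff r hr _).2 f.2⟩
  left_inv _ := rfl
  right_inv _ := rfl

/-- the set `k_≺((x_1,…,x_n))` of formal Laurent series is a commutative
ring under the pointwise addition and the convolution multiplication, and it is a field
whenever `k` is a field. -/
theorem stmt_3 (n : ℕ) (k : Type*) [CommRing k]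
    (r : (Fin n → ℤ) → (Fin n → ℤ) → Prop)
    (htot : IsStrictTotalOrder (Fin n → ℤ) r)
    (hadd : ∀ a b c : Fin n → ℤ, r a b → r (a + c) (b + c)) :
    ∃ inst : CommRing {f : (Fin n → ℤ) → k // IsLaurentSupported k r f},
      (∀ f g : {f : (Fin n → ℤ) → k // IsLaurentSupported k r f}, ∀ c,
          (inst.add f g).1 c = f.1 c + g.1 c) ∧
      (∀ f g : {f : (Fin n → ℤ) → k // IsLaurentSupported k r f}, ∀ c,
          {p : (Fin n → ℤ) × (Fin n → ℤ) |
            p.1 + p.2 = c ∧ f.1 p.1 ≠ 0 ∧ g.1 p.2 ≠ 0}.Finite) ∧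
      (∀ f g : {f : (Fin n → ℤ) → k // IsLaurentSupported k r f}, ∀ c,
          (inst.mul f g).1 c =
            ∑ᶠ p ∈ {p : (Fin n → ℤ) × (Fin n → ℤ) | p.1 + p.2 = c}, f.1 p.1 * g.1 p.2) ∧
      ((inst.one).1 = fun c => if c = 0 then 1 else 0) ∧
      ((inst.zero).1 = fun _ => 0) ∧
      (IsField k →
        inst.one ≠ inst.zero ∧
        ∀ f : {f : (Fin n → ℤ) → k // IsLaurentSupported k r f},
          f ≠ inst.zero → ∃ g, inst.mul f g = inst.one) := by
  classical
  letI ord : LinearOrder (OG n) := @linearOrderOfSTO (Fin n → ℤ) r htot (Classical.decRel _)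
  have hr : ∀ a b : OG n, a < b ↔ r a b := fun a b => Iff.rfl
  haveI : IsOrderedAddMonoid (OG n) :=
    { add_le_add_left := by
        intro a b hab c
        rcases eq_or_lt_of_le hab with rfl | h
        · exact le_refl _
        · exact le_of_lt ((hr _ _).2 (hadd a b c ((hr _ _).1 h))) }
  let E := laurentEquiv k r hr
  have hfin : ∀ f g : {f : (Fin n → ℤ) → k // IsLaurentSupported k r f}, ∀ c,
      {p : (Fin n → ℤ) × (Fin n → ℤ) |
        p.1 + p.2 = c ∧ f.1 p.1 ≠ 0 ∧ g.1 p.2 ≠ 0} =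
      ((Finset.antidiagonal (E f).1.isPWO_support (E g).1.isPWO_support c :
        Finset (OG n × OG n)) : Set (OG n × OG n)) := by
    intro f g c
    ext p
    refine Iff.trans ?_ (Finset.mem_coe.trans Finset.mem_antidiagonal).symm
    constructor
    · rintro ⟨h1, h2, h3⟩
      exact ⟨h2, h3, h1⟩
    · rintro ⟨h2, h3, h1⟩
      exact ⟨h1, h2, h3⟩
  refine ⟨E.commRing, fun f g c => rfl, ?_, ?_, ?_, rfl, ?_⟩
  · intro f g c
    rw [hfin]
    exact Finset.finite_toSet _
  · intro f g c
    refine Eq.trans (HahnSeries.coeff_mul (x := (E f).1) (y := (E g).1) (a := (c : OG n))) ?_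
    symm
    refine finsum_mem_eq_sum_of_inter_support_eq
      (fun p : (Fin n → ℤ) × (Fin n → ℤ) => f.1 p.1 * g.1 p.2) ?_
    have h := hfin f g c
    refine Eq.trans ?_ (congrArg (· ∩ Function.support
      (fun p : (Fin n → ℤ) × (Fin n → ℤ) => f.1 p.1 * g.1 p.2)) h)
    ext p
    constructor
    · rintro ⟨h1, h2⟩
      exact ⟨⟨h1, left_ne_zero_of_mul h2, right_ne_zero_of_mul h2⟩, h2⟩
    · rintro ⟨h1, h2⟩
      exact ⟨h1.1, h2⟩
  · funext c
    by_cases hc : c = 0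
    · rw [if_pos hc]
      exact (HahnSeries.coeff_one (Γ := OG n) (R := k) (a := c)).trans (if_pos hc)
    · rw [if_neg hc]
      exact (HahnSeries.coeff_one (Γ := OG n) (R := k) (a := c)).trans (if_neg hc)
  · intro hk
    haveI := hk.isDomain
    constructor
    · intro h
      have h1 := congrArg (fun x => (E x).1.coeff 0) h
      change (1 : HahnSeries (OG n) k).coeff 0 = 0 at h1
      simp at h1
    · intro f hf
      have hf0 : (E f).1 ≠ 0 := by
        intro h
        apply hf
        apply Subtype.ext
        exact congrArg HahnSeries.coeff h
      have hu : IsUnit (E f).1 := by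
        rw [HahnSeries.isUnit_iff]
        obtain ⟨b, hb⟩ := hk.mul_inv_cancel (HahnSeries.leadingCoeff_ne_zero.2 hf0)
        exact IsUnit.of_mul_eq_one _ hb
      obtain ⟨g, hg⟩ := hu.exists_right_inv
      let g' : laurentSubring (OG n) k := ⟨g, laurent_inv _ _ (E f).2 hg⟩
      refine ⟨E.symm g', ?_⟩
      apply Subtype.ext
      exact congrArg HahnSeries.coeff hg
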